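/- For every positive integer i and fixed y > 0, the partial derivative with respect to x of f(x,y) = |ψ^(i)(x)| + |ψ^(i)(y)| − |ψ^(i)(xy)| equals (1/x)·[xy·|ψ^(i+1)(xy)| − x·|ψ^(i+1)(x)|], and this is positive when 0 < y < 1 and negative when y > 1. -/

import Mathlib

noncomputable def digamma : ℝ → ℝ := deriv (fun x => Real.log (Real.Gamma x))

noncomputable def polygamma (i : ℕ) : ℝ → ℝ := iteratedDeriv i digamma

open Set Filter Topology

/-- The Hurwitz-type series `∑ 1 / (x + k) ^ m`. -/
noncomputable def shiftedPowerSum (m : ℕ) (x : ℝ) : ℝ := ∑' k : ℕ, ((x + k) ^ m)⁻¹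

lemma summable_inv_add_nat_pow {m : ℕ} (hm : 2 ≤ m) {x : ℝ} (hx : 0 < x) :
    Summable fun k : ℕ => ((x + k) ^ m)⁻¹ := by
  have h := (Real.summable_one_div_nat_add_rpow x m).2 (by exact_mod_cast hm)
  refine h.congr fun k => ?_
  have : 0 < (k : ℝ) + x := by positivity
  rw [abs_of_pos this, Real.rpow_natCast, one_div, add_comm]

lemma shiftedPowerSum_pos {m : ℕ} (hm : 2 ≤ m) {x : ℝ} (hx : 0 < x) :
    0 < shiftedPowerSum m x :=
  (summable_inv_add_nat_pow hm hx).tsum_pos (fun _ => by positivity) 0 (by positivity)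

lemma hasDerivAt_inv_add_pow (m : ℕ) (c : ℝ) {x : ℝ} (hx : x + c ≠ 0) :
    HasDerivAt (fun t : ℝ => ((t + c) ^ m)⁻¹) (-m * ((x + c) ^ (m + 1))⁻¹) x := by
  have h := (((hasDerivAt_id' x).add_const c).fun_pow m).fun_inv (pow_ne_zero m hx)
  refine h.congr_deriv ?_
  rcases m with _ | m
  · simp
  · simp only [Nat.add_sub_cancel]
    field_simp
    ring

lemma hasDerivAt_shiftedPowerSum {m : ℕ} (hm : 2 ≤ m) {x : ℝ} (hx : 0 < x) :
    HasDerivAt (shiftedPowerSum m) (-m * shiftedPowerSum (m + 1) x) x := by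
  have hx2 : 0 < x / 2 := by positivity
  have hmem : x ∈ Ioi (x / 2) := by simp only [mem_Ioi]; linarith
  have hsum : -m * shiftedPowerSum (m + 1) x = ∑' k : ℕ, -m * ((x + k) ^ (m + 1))⁻¹ :=
    tsum_mul_left.symm
  rw [hsum]
  refine hasDerivAt_tsum_of_isPreconnected (t := Ioi (x / 2))
    (g := fun (k : ℕ) (t : ℝ) => ((t + k) ^ m)⁻¹)
    (g' := fun (k : ℕ) (t : ℝ) => -m * ((t + k) ^ (m + 1))⁻¹)
    ((summable_inv_add_nat_pow (m := m + 1) (by lia) hx2).mul_left (m : ℝ))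
    isOpen_Ioi isPreconnected_Ioi (fun k y hy => ?_) (fun k y hy => ?_) hmem
    (summable_inv_add_nat_pow hm hx) hmem
  · have hy0 : 0 < y := hx2.trans hy
    exact hasDerivAt_inv_add_pow m k (by positivity)
  · have hy0 : 0 < y := hx2.trans hy
    have hle : x / 2 ≤ y := (mem_Ioi.1 hy).le
    rw [norm_mul, norm_neg, Real.norm_natCast, Real.norm_of_nonneg (by positivity)]
    gcongr

lemma differentiableAt_log_Gamma {x : ℝ} (hx : 0 < x) :
    DifferentiableAt ℝ (fun x => Real.log (Real.Gamma x)) x :=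
  (Real.differentiableAt_Gamma fun m => by
    have : (0 : ℝ) ≤ m := m.cast_nonneg
    linarith).log (Real.Gamma_pos_of_pos hx).ne'

lemma monotoneOn_digamma : MonotoneOn digamma (Ioi 0) :=
  Real.convexOn_log_Gamma.monotoneOn_deriv fun _ hx => differentiableAt_log_Gamma hx

lemma digamma_add_one {x : ℝ} (hx : 0 < x) : digamma (x + 1) = digamma x + x⁻¹ := by
  have hev : (fun t => Real.log (Real.Gamma (t + 1))) =ᶠ[𝓝 x]
      fun t => Real.log t + Real.log (Real.Gamma t) := by
    filter_upwards [lt_mem_nhds hx] with t ht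
    rw [Real.Gamma_add_one ht.ne', Real.log_mul ht.ne' (Real.Gamma_pos_of_pos ht).ne']
  have h := hev.deriv_eq
  rw [deriv_comp_add_const (f := fun t => Real.log (Real.Gamma t)),
    deriv_fun_add (Real.differentiableAt_log hx.ne') (differentiableAt_log_Gamma hx),
    Real.deriv_log] at h
  exact h.trans (add_comm _ _)

lemma digamma_add_nat {x : ℝ} (hx : 0 < x) (n : ℕ) :
    digamma (x + n) = digamma x + ∑ k ∈ Finset.range n, (x + k)⁻¹ := by
  induction n with
  | zero => simp
  | succ n ih =>
    rw [Finset.sum_range_succ, Nat.cast_succ, ← add_assoc, digamma_add_one (by positivity), ih,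
      add_assoc]

lemma tendsto_digamma_add_nat_sub {a b : ℝ} (ha : 0 < a) (hab : a ≤ b) :
    Tendsto (fun n : ℕ => digamma (b + n) - digamma (a + n)) atTop (𝓝 0) := by
  obtain ⟨N, hN⟩ := exists_nat_ge (b - a)
  have hlim : Tendsto (fun n : ℕ => ∑ k ∈ Finset.range N, (a + n + k)⁻¹) atTop (𝓝 0) := by
    rw [← Finset.sum_const_zero (s := Finset.range N)]
    refine tendsto_finsetSum _ fun k _ => ?_
    exact tendsto_inv_atTop_zero.comp (tendsto_atTop_add_const_right _ _
      (tendsto_atTop_add_const_left _ _ tendsto_natCast_atTop_atTop))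
  refine squeeze_zero (fun n => ?_) (fun n => ?_) hlim
  · refine sub_nonneg.2 (monotoneOn_digamma ?_ ?_ ?_)
    · simp only [mem_Ioi]; positivity
    · have : 0 < b := ha.trans_le hab
      simp only [mem_Ioi]; positivity
    · linarith
  · rw [sub_le_iff_le_add', ← digamma_add_nat (by positivity)]
    refine monotoneOn_digamma ?_ ?_ ?_
    · have : 0 < b := ha.trans_le hab
      simp only [mem_Ioi]; positivity
    · simp only [mem_Ioi]; positivity
    · linarith

lemma tendsto_sum_inv_sub_inv {x : ℝ} (hx : 0 < x) :
    Tendsto (fun n : ℕ => ∑ k ∈ Finset.range n, ((1 + k : ℝ)⁻¹ - (x + k)⁻¹)) atTop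
      (𝓝 (digamma x - digamma 1)) := by
  have h : Tendsto (fun n : ℕ => digamma (x + n) - digamma (1 + n)) atTop (𝓝 0) := by
    rcases le_total 1 x with h1 | h1
    · exact tendsto_digamma_add_nat_sub one_pos h1
    · simpa using (tendsto_digamma_add_nat_sub hx h1).neg
  have h2 := h.const_sub (digamma x - digamma 1)
  rw [sub_zero] at h2
  refine h2.congr fun n => ?_
  rw [digamma_add_nat hx, digamma_add_nat one_pos, Finset.sum_sub_distrib]
  ring

lemma hasDerivAt_digamma {x : ℝ} (hx : 0 < x) :
    HasDerivAt digamma (shiftedPowerSum 2 x) x := by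
  obtain ⟨a, ha, hax⟩ := exists_between (lt_min hx one_pos)
  have hmem : x ∈ Ioi a := hax.trans_le (min_le_left _ _)
  have hmem1 : (1 : ℝ) ∈ Ioi a := hax.trans_le (min_le_right _ _)
  have hu := summable_inv_add_nat_pow le_rfl ha
  have hg (k : ℕ) (y : ℝ) (hy : y ∈ Ioi a) :
      HasDerivAt (fun t : ℝ => (1 + k : ℝ)⁻¹ - (t + k)⁻¹) ((y + k) ^ 2)⁻¹ y := by
    have hy0 : 0 < y := ha.trans hy
    simpa using (hasDerivAt_inv_add_pow 1 k (x := y) (by positivity)).const_sub (1 + k : ℝ)⁻¹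
  have hg' (k : ℕ) (y : ℝ) (hy : y ∈ Ioi a) : ‖((y + k) ^ 2)⁻¹‖ ≤ ((a + k) ^ 2)⁻¹ := by
    have hle : a ≤ y := (mem_Ioi.1 hy).le
    rw [Real.norm_of_nonneg (by positivity)]
    gcongr
  have hg0 : Summable fun k : ℕ => (1 + k : ℝ)⁻¹ - (1 + k : ℝ)⁻¹ := by simp [summable_zero]
  have hder := hasDerivAt_tsum_of_isPreconnected hu isOpen_Ioi isPreconnected_Ioi hg hg' hmem1
    hg0 hmem
  refine (hder.const_add (digamma 1)).congr_of_eventuallyEq ?_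
  filter_upwards [lt_mem_nhds hmem] with y hy
  have hs := summable_of_summable_hasDerivAt_of_isPreconnected hu isOpen_Ioi isPreconnected_Ioi
    hg hg' hmem1 hg0 hy
  have := tendsto_nhds_unique hs.hasSum.tendsto_sum_nat (tendsto_sum_inv_sub_inv (ha.trans hy))
  rw [this]
  ring

lemma polygamma_succ_eq (m : ℕ) {x : ℝ} (hx : 0 < x) :
    polygamma (m + 1) x = (-1) ^ m * (m + 1).factorial * shiftedPowerSum (m + 2) x := by
  induction m generalizing x with
  | zero => simpa [polygamma] using (hasDerivAt_digamma hx).deriv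
  | succ m ih =>
    have hev : polygamma (m + 1) =ᶠ[𝓝 x]
        fun t => (-1) ^ m * (m + 1).factorial * shiftedPowerSum (m + 2) t := by
      filter_upwards [lt_mem_nhds hx] with t ht using ih ht
    have h : polygamma (m + 1 + 1) x = deriv (polygamma (m + 1)) x := by
      rw [polygamma, iteratedDeriv_succ]
      rfl
    rw [h, hev.deriv_eq, ((hasDerivAt_shiftedPowerSum (by lia) hx).const_mul _).deriv,
      Nat.factorial_succ (m + 1)]
    push_cast
    ring

lemma abs_polygamma {i : ℕ} (hi : 0 < i) {x : ℝ} (hx : 0 < x) :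
    |polygamma i x| = i.factorial * shiftedPowerSum (i + 1) x := by
  obtain ⟨m, rfl⟩ := Nat.exists_eq_add_of_lt hi
  rw [zero_add, polygamma_succ_eq m hx, abs_mul, abs_mul, abs_pow, abs_neg, abs_one, one_pow,
    one_mul, Nat.abs_cast, abs_of_pos (shiftedPowerSum_pos (by lia) hx)]

lemma hasDerivAt_abs_polygamma {i : ℕ} (hi : 0 < i) {x : ℝ} (hx : 0 < x) :
    HasDerivAt (fun t => |polygamma i t|) (-|polygamma (i + 1) x|) x := by
  have h := (hasDerivAt_shiftedPowerSum (m := i + 1) (by lia) hx).const_mul (i.factorial : ℝ)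
  have heq : -|polygamma (i + 1) x| =
      i.factorial * (-((i + 1 : ℕ) : ℝ) * shiftedPowerSum (i + 1 + 1) x) := by
    rw [abs_polygamma (by lia) hx, Nat.factorial_succ]
    push_cast
    ring
  rw [heq]
  refine h.congr_of_eventuallyEq ?_
  filter_upwards [lt_mem_nhds hx] with t ht using abs_polygamma hi ht

/-- The tangent-line inequality for the convex function `s ↦ 1 / s ^ m`. -/
lemma mul_inv_pow_succ_le {m : ℕ} {s : ℝ} (hs : 0 < s) :
    m * ((s + 1) ^ (m + 1))⁻¹ ≤ (s ^ m)⁻¹ - ((s + 1) ^ m)⁻¹ := by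
  have hb := one_add_mul_le_pow (a := s⁻¹) (by have := inv_pos.2 hs; linarith) m
  have h1 : (1 + s⁻¹) ^ m = (s + 1) ^ m * (s ^ m)⁻¹ := by
    rw [← inv_pow, ← mul_pow]; congr 1; field_simp
  have h2 : (m : ℝ) * (s + 1)⁻¹ ≤ m * s⁻¹ := by gcongr; linarith
  have h3 : 1 + (m : ℝ) * (s + 1)⁻¹ ≤ (s + 1) ^ m * (s ^ m)⁻¹ := by linarith
  have h4 : ((s + 1) ^ m)⁻¹ * (1 + (m : ℝ) * (s + 1)⁻¹) ≤
      ((s + 1) ^ m)⁻¹ * ((s + 1) ^ m * (s ^ m)⁻¹) := by gcongr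
  rw [inv_mul_cancel_left₀ (by positivity)] at h4
  rw [pow_succ, mul_inv]
  linarith

/-- The derivative of `t ↦ t * shiftedPowerSum m t` is negative; the bound comes from a telescoping
comparison based on convexity. -/
lemma shiftedPowerSum_lt {m : ℕ} (hm : 3 ≤ m) {x : ℝ} (hx : 0 < x) :
    shiftedPowerSum m x < m * x * shiftedPowerSum (m + 1) x := by
  have hsum := (summable_inv_add_nat_pow (m := m) (by lia) hx).hasSum.tendsto_sum_nat
  have hsum' := (summable_inv_add_nat_pow (m := m + 1) (by lia) hx).hasSum.tendsto_sum_nat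
  have key (n : ℕ) : ((m : ℝ) - 1) * ∑ k ∈ Finset.range (n + 1), ((x + k) ^ m)⁻¹ +
      (n + 1) * ((x + n) ^ m)⁻¹ ≤
      m * x * ∑ k ∈ Finset.range (n + 1), ((x + k) ^ (m + 1))⁻¹ := by
    induction n with
    | zero =>
      refine le_of_eq ?_
      simp only [zero_add, Finset.range_one, Finset.sum_singleton, Nat.cast_zero, add_zero]
      field_simp
      ring
    | succ n ih =>
      rw [Finset.sum_range_succ _ (n + 1), Finset.sum_range_succ _ (n + 1)]
      have ht := mul_inv_pow_succ_le (m := m) (s := x + n) (by positivity)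
      have ht' := mul_le_mul_of_nonneg_left ht (by positivity : (0 : ℝ) ≤ n + 1)
      have hB : ((x + n + 1) ^ m)⁻¹ = (x + n + 1) * ((x + n + 1) ^ (m + 1))⁻¹ := by
        field_simp
        ring
      push_cast
      rw [← add_assoc]
      linear_combination ih + ht' + (m : ℝ) * hB
  have hle : ((m : ℝ) - 1) * shiftedPowerSum m x ≤ m * x * shiftedPowerSum (m + 1) x := by
    refine le_of_tendsto_of_tendsto' ((hsum.comp (tendsto_add_atTop_nat 1)).const_mul _)
      ((hsum'.comp (tendsto_add_atTop_nat 1)).const_mul _) fun n => ?_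
    have : 0 ≤ ((n : ℝ) + 1) * ((x + n) ^ m)⁻¹ := by positivity
    have := key n
    simp only [Function.comp_apply]
    linarith
  have hm' : (3 : ℝ) ≤ m := by exact_mod_cast hm
  nlinarith [shiftedPowerSum_pos (m := m) (by lia) hx]

lemma strictAntiOn_mul_abs_polygamma {i : ℕ} (hi : 2 ≤ i) :
    StrictAntiOn (fun t => t * |polygamma i t|) (Ioi 0) := by
  have hder {t : ℝ} (ht : 0 < t) := (hasDerivAt_id t).mul (hasDerivAt_abs_polygamma (i := i)
    (by lia) ht)
  refine strictAntiOn_of_deriv_neg (convex_Ioi 0)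
    (fun t ht => (hder ht).continuousAt.continuousWithinAt) fun t ht => ?_
  rw [interior_Ioi] at ht
  have h := mul_lt_mul_of_pos_left (shiftedPowerSum_lt (m := i + 1) (by lia) ht)
    (Nat.cast_pos.2 i.factorial_pos : (0 : ℝ) < i.factorial)
  refine (hder ht).deriv.trans_lt ?_
  rw [abs_polygamma (by lia) ht, abs_polygamma (by lia) ht, Nat.factorial_succ]
  simp only [id]
  push_cast at h ⊢
  linarith

theorem stmt17 (i : ℕ) (hi : 0 < i) (y : ℝ) (hy : 0 < y) (x : ℝ) (hx : 0 < x) :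
    deriv (fun t : ℝ => |polygamma i t| + |polygamma i y| - |polygamma i (t * y)|) x =
      (1 / x) * (x * y * |polygamma (i + 1) (x * y)| - x * |polygamma (i + 1) x|) ∧
    (y < 1 → 0 < (1 / x) * (x * y * |polygamma (i + 1) (x * y)| - x * |polygamma (i + 1) x|)) ∧
    (1 < y → (1 / x) * (x * y * |polygamma (i + 1) (x * y)| - x * |polygamma (i + 1) x|) < 0) := by
  have hxy : 0 < x * y := mul_pos hx hy
  have hanti := strictAntiOn_mul_abs_polygamma (i := i + 1) (by lia)
  refine ⟨?_, fun h => ?_, fun h => ?_⟩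
  · have h2 := (hasDerivAt_abs_polygamma hi hxy).comp x ((hasDerivAt_id' x).mul_const y)
    have h1 := ((hasDerivAt_abs_polygamma hi hx).add_const |polygamma i y|).sub h2
    refine h1.deriv.trans ?_
    field_simp
    ring
  · have hlt : x * y < x := mul_lt_of_lt_one_right hx h
    exact mul_pos (one_div_pos.2 hx) (sub_pos.2 (hanti hxy hx hlt))
  · have hlt : x < x * y := lt_mul_of_one_lt_right hx h
    exact mul_neg_of_pos_of_neg (one_div_pos.2 hx) (sub_neg.2 (hanti hx hxy hlt))
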